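/- Every planar graph is 5-choosable: if G is a planar simple graph and L assigns to each vertex a list of at least 5 colors, then G has a proper coloring with each vertex colored from its own list. -/

import Mathlib

/-- A graph is planar if it has a drawing in the plane: an injective placement of
vertices and, for each edge, an injective continuous arc joining the images of its
endpoints, such that arcs meet vertex images only at their endpoints and distinct arcs
meet only at images of vertices. -/
def IsPlanar {V : Type*} (G : SimpleGraph V) : Prop :=
  ∃ (pos : V → ℝ × ℝ) (arc : G.edgeSet → (Set.Icc (0 : ℝ) 1 → ℝ × ℝ)),
    Function.Injective pos ∧
    (∀ e, Continuous (arc e)) ∧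
    (∀ e, Function.Injective (arc e)) ∧
    (∀ e : G.edgeSet, ∃ u v : V, (e : Sym2 V) = s(u, v) ∧
      arc e ⟨0, by norm_num⟩ = pos u ∧ arc e ⟨1, by norm_num⟩ = pos v) ∧
    (∀ e : G.edgeSet, ∀ t : Set.Icc (0 : ℝ) 1, arc e t ∈ Set.range pos →
      t = ⟨0, by norm_num⟩ ∨ t = ⟨1, by norm_num⟩) ∧
    (∀ e f : G.edgeSet, e ≠ f → ∀ s t, arc e s = arc f t → arc e s ∈ Set.range pos)


open unitInterval in
theorem exists_log_path (f : I → ℂ) (hf : Continuous f) (h0 : ∀ t, f t ≠ 0) :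
    ∃ g : I → ℂ, Continuous g ∧ ∀ t, Complex.exp (g t) = f t := by
  let F : C(I, {z : ℂ // z ≠ 0}) := ⟨fun t => ⟨f t, h0 t⟩, by fun_prop⟩
  have hF : F 0 = (fun z : ℂ ↦ (⟨_, z.exp_ne_zero⟩ : {z : ℂ // z ≠ 0})) (Complex.log (f 0)) := by
    apply Subtype.ext
    simp [F, Complex.exp_log (h0 0)]
  refine ⟨Complex.isCoveringMap_exp.liftPath F _ hF, ContinuousMap.continuous _, fun t => ?_⟩
  have := congr_fun (Complex.isCoveringMap_exp.liftPath_lifts F _ hF) t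
  exact congrArg Subtype.val this

open unitInterval in
theorem exists_log_square (f : I × I → ℂ) (hf : Continuous f) (h0 : ∀ t, f t ≠ 0) :
    ∃ g : I × I → ℂ, Continuous g ∧ ∀ t, Complex.exp (g t) = f t := by
  obtain ⟨g0, hg0, hg0'⟩ := exists_log_path (fun t => f (0, t)) (by fun_prop) (fun t => h0 _)
  let F : C(I × I, {z : ℂ // z ≠ 0}) := ⟨fun t => ⟨f t, h0 t⟩, by fun_prop⟩
  have hF : ∀ a, F (0, a) = (fun z : ℂ ↦ (⟨_, z.exp_ne_zero⟩ : {z : ℂ // z ≠ 0}))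
      ((⟨g0, hg0⟩ : C(I, ℂ)) a) := by
    intro a
    apply Subtype.ext
    simp [F, hg0']
  refine ⟨Complex.isCoveringMap_exp.liftHomotopy F _ hF, ContinuousMap.continuous _, fun t => ?_⟩
  have := congr_fun (Complex.isCoveringMap_exp.liftHomotopy_lifts F _ hF) t
  exact congrArg Subtype.val this

open unitInterval in
theorem log_unique (g g' : I → ℂ) (hg : Continuous g) (hg' : Continuous g')
    (h : ∀ t, Complex.exp (g t) = Complex.exp (g' t)) : g 1 - g 0 = g' 1 - g' 0 := by
  have key : g = fun t => g' t + (g 0 - g' 0) := by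
    refine Complex.isCoveringMap_exp.eq_of_comp_eq hg (by fun_prop) ?_ 0 (by ring)
    ext t
    have h1 : Complex.exp (g 0 - g' 0) = 1 := by
      rw [Complex.exp_sub, h 0, div_self (Complex.exp_ne_zero _)]
    simp [Complex.exp_add, h1, h t]
  have := congr_fun key 1
  rw [this]; ring

open unitInterval in
/-- The total variation of the logarithm along a path (junk if the path hits zero). -/
noncomputable def logVar (f : I → ℂ) : ℂ :=
  open Classical in
  if h : ∃ g : I → ℂ, Continuous g ∧ ∀ t, Complex.exp (g t) = f t then
    h.choose 1 - h.choose 0 else 0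

open unitInterval in
theorem logVar_eq (f g : I → ℂ) (hg : Continuous g) (h : ∀ t, Complex.exp (g t) = f t) :
    logVar f = g 1 - g 0 := by
  have hex : ∃ g : I → ℂ, Continuous g ∧ ∀ t, Complex.exp (g t) = f t := ⟨g, hg, h⟩
  rw [logVar, dif_pos hex]
  exact log_unique _ _ hex.choose_spec.1 hg (fun t => by rw [hex.choose_spec.2 t, h t])

open unitInterval in
theorem logVar_neg (f f' : I → ℂ) (hf : Continuous f) (h0 : ∀ t, f t ≠ 0)
    (hff : ∀ t, f' t = - f t) : logVar f' = logVar f := by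
  obtain ⟨g, hg, hg'⟩ := exists_log_path f hf h0
  rw [logVar_eq f g hg hg', logVar_eq f' (fun t => g t + Real.pi * Complex.I) (by fun_prop)]
  · ring
  · intro t
    rw [Complex.exp_add, hg', Complex.exp_pi_mul_I, hff]; ring

open unitInterval in
theorem exp_logVar (f : I → ℂ) (hf : Continuous f) (h0 : ∀ t, f t ≠ 0) :
    Complex.exp (logVar f) = f 1 / f 0 := by
  obtain ⟨g, hg, hg'⟩ := exists_log_path f hf h0
  rw [logVar_eq f g hg hg', Complex.exp_sub, hg', hg']

open unitInterval in
theorem square_rel {a b c d : ℂ} (γ : Path a b) (δ : Path c d) (h : ∀ s t, γ s ≠ δ t) :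
    logVar (fun s => γ s - c) + logVar (fun t => δ t - b) =
      logVar (fun s => γ s - d) + logVar (fun t => δ t - a) := by
  obtain ⟨g, hg, hg'⟩ := exists_log_square (fun p => γ p.1 - δ p.2) (by fun_prop)
    (fun p => sub_ne_zero.2 (h _ _))
  have e1 : logVar (fun s => γ s - c) = g (1, 0) - g (0, 0) :=
    logVar_eq _ (fun s => g (s, 0)) (by fun_prop) (fun s => by simp [hg'])
  have e2 : logVar (fun s => γ s - d) = g (1, 1) - g (0, 1) :=
    logVar_eq _ (fun s => g (s, 1)) (by fun_prop) (fun s => by simp [hg'])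
  have e3 : logVar (fun t => b - δ t) = g (1, 1) - g (1, 0) :=
    logVar_eq _ (fun s => g (1, s)) (by fun_prop) (fun s => by simp [hg'])
  have e4 : logVar (fun t => a - δ t) = g (0, 1) - g (0, 0) :=
    logVar_eq _ (fun s => g (0, s)) (by fun_prop) (fun s => by simp [hg'])
  have e5 : logVar (fun t => δ t - b) = logVar (fun t => b - δ t) :=
    logVar_neg _ _ (by fun_prop) (fun t => sub_ne_zero.2 (by have := h 1 t; simpa using this))
      (fun t => by ring)
  have e6 : logVar (fun t => δ t - a) = logVar (fun t => a - δ t) :=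
    logVar_neg _ _ (by fun_prop) (fun t => sub_ne_zero.2 (by have := h 0 t; simpa using this))
      (fun t => by ring)
  rw [e5, e6, e1, e2, e3, e4]; ring

/-- A sign: `0` if `i < j`, else `1`. -/
def ordBit {m : ℕ} (i j : Fin m) : ℤ := if i < j then 0 else 1

theorem exists_cochain {m : ℕ} (p : Fin m → ℂ) (hp : Function.Injective p)
    (E : Fin m → Fin m → Prop) (γ : ∀ i j, E i j → Path (p i) (p j))
    (hpt : ∀ i j (h : E i j) k, k ≠ i → k ≠ j → ∀ t, γ i j h t ≠ p k)
    (hdis : ∀ i j (h : E i j) k l (h' : E k l), i ≠ k → i ≠ l → j ≠ k → j ≠ l →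
      ∀ s t, γ i j h s ≠ γ k l h' t) :
    ∃ n : Fin m → Fin m → Fin m → ℤ, ∀ i j k l, E i j → E k l →
      i ≠ k → i ≠ l → j ≠ k → j ≠ l → 
      2 * (n k i j + n j k l - n l i j - n i k l) =
        (ordBit l j - ordBit j l) + (ordBit j k - ordBit k j) + (ordBit k i - ordBit i k)
        + (ordBit i l - ordBit l i) := by
  let lam : Fin m → Fin m → ℂ := fun i j =>
    Complex.log (p (max i j) - p (min i j)) + ordBit i j * (Real.pi * Complex.I)
  have hlam : ∀ i j, i ≠ j → Complex.exp (lam i j) = p j - p i := by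
    intro i j hij
    have hne : p (max i j) - p (min i j) ≠ 0 := by
      rw [sub_ne_zero]
      intro h
      have := hp h
      rcases lt_or_gt_of_ne hij with h | h
      · rw [max_eq_right h.le, min_eq_left h.le] at this; exact hij this.symm
      · rw [max_eq_left h.le, min_eq_right h.le] at this; exact hij this
    simp only [lam]
    rw [Complex.exp_add, Complex.exp_log hne]
    rcases lt_or_gt_of_ne hij with h | h
    · rw [max_eq_right h.le, min_eq_left h.le]; simp [ordBit, h]
    · rw [max_eq_left h.le, min_eq_right h.le]; simp [ordBit, h.not_gt]
  have hD : ∀ k i j, ∃ n : ℤ, ∀ h : E i j, k ≠ i → k ≠ j →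
      logVar (fun s => γ i j h s - p k) = lam k j - lam k i + n * (2 * Real.pi * Complex.I) := by
    intro k i j
    by_cases hh : E i j ∧ k ≠ i ∧ k ≠ j
    · obtain ⟨h, h1, h2⟩ := hh
      have hv := exp_logVar (fun s => γ i j h s - p k) (by fun_prop)
        (fun t => sub_ne_zero.2 (hpt i j h k h1 h2 t))
      simp only [Path.target, Path.source] at hv
      rw [← hlam k j h2, ← hlam k i h1, ← Complex.exp_sub, Complex.exp_eq_exp_iff_exists_int] at hv
      obtain ⟨n, hn⟩ := hv
      exact ⟨n, fun _ _ _ => hn⟩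
    · exact ⟨0, fun h h1 h2 => absurd ⟨h, h1, h2⟩ hh⟩
  choose n hn using hD
  refine ⟨n, fun i j k l hE hE' hik hil hjk hjl => ?_⟩
  have hs := square_rel (γ i j hE) (γ k l hE') (hdis i j hE k l hE' hik hil hjk hjl)
  rw [hn k i j hE hik.symm hjk.symm, hn j k l hE' hjk hjl, hn l i j hE hil.symm hjl.symm,
    hn i k l hE' hik hil] at hs
  simp only [lam] at hs
  have hpi : (Real.pi * Complex.I : ℂ) ≠ 0 := by simp [Real.pi_ne_zero]
  have : (Real.pi * Complex.I : ℂ) * ((2 * (n k i j + n j k l - n l i j - n i k l) : ℤ) : ℂ) =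
      (Real.pi * Complex.I : ℂ) * (((ordBit l j - ordBit j l) + (ordBit j k - ordBit k j) +
        (ordBit k i - ordBit i k) + (ordBit i l - ordBit l i) : ℤ) : ℂ) := by
    push_cast
    rw [max_comm k j, min_comm k j, max_comm k i, min_comm k i, max_comm j l, min_comm j l, max_comm i l,
      min_comm i l] at hs
    linear_combination hs
  exact_mod_cast mul_left_cancel₀ hpi this

theorem no_cochain_K5 (n : Fin 5 → Fin 5 → Fin 5 → ℤ)
    (h : ∀ i j k l, i < j → k < l → i ≠ k → i ≠ l → j ≠ k → j ≠ l → 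
      2 * (n k i j + n j k l - n l i j - n i k l) =
        (ordBit l j - ordBit j l) + (ordBit j k - ordBit k j) + (ordBit k i - ordBit i k)
        + (ordBit i l - ordBit l i)) : False := by
  have a0 := h 0 1 2 3 (by decide) (by decide) (by decide) (by decide) (by decide) (by decide)
  have a1 := h 0 2 1 3 (by decide) (by decide) (by decide) (by decide) (by decide) (by decide)
  have a2 := h 0 3 1 2 (by decide) (by decide) (by decide) (by decide) (by decide) (by decide)
  have b0 := h 0 1 2 4 (by decide) (by decide) (by decide) (by decide) (by decide) (by decide)
  have b1 := h 0 2 1 4 (by decide) (by decide) (by decide) (by decide) (by decide) (by decide)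
  have b2 := h 0 4 1 2 (by decide) (by decide) (by decide) (by decide) (by decide) (by decide)
  have c0 := h 0 1 3 4 (by decide) (by decide) (by decide) (by decide) (by decide) (by decide)
  have c1 := h 0 3 1 4 (by decide) (by decide) (by decide) (by decide) (by decide) (by decide)
  have c2 := h 0 4 1 3 (by decide) (by decide) (by decide) (by decide) (by decide) (by decide)
  have d0 := h 0 2 3 4 (by decide) (by decide) (by decide) (by decide) (by decide) (by decide)
  have d1 := h 0 3 2 4 (by decide) (by decide) (by decide) (by decide) (by decide) (by decide)
  have d2 := h 0 4 2 3 (by decide) (by decide) (by decide) (by decide) (by decide) (by decide)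
  have e0 := h 1 2 3 4 (by decide) (by decide) (by decide) (by decide) (by decide) (by decide)
  have e1 := h 1 3 2 4 (by decide) (by decide) (by decide) (by decide) (by decide) (by decide)
  have e2 := h 1 4 2 3 (by decide) (by decide) (by decide) (by decide) (by decide) (by decide)
  simp [ordBit] at a0 a1 a2 b0 b1 b2 c0 c1 c2 d0 d1 d2 e0 e1 e2
  omega

theorem no_cochain_K33 (n : Fin 6 → Fin 6 → Fin 6 → ℤ)
    (h : ∀ i j k l, (i < 3 ∧ 3 ≤ j) → (k < 3 ∧ 3 ≤ l) → i ≠ k → i ≠ l → j ≠ k → j ≠ l → 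
      2 * (n k i j + n j k l - n l i j - n i k l) =
        (ordBit l j - ordBit j l) + (ordBit j k - ordBit k j) + (ordBit k i - ordBit i k)
        + (ordBit i l - ordBit l i)) : False := by
  have a0 := h 0 3 1 4 (by decide) (by decide) (by decide) (by decide) (by decide) (by decide)
  have a1 := h 0 3 1 5 (by decide) (by decide) (by decide) (by decide) (by decide) (by decide)
  have a2 := h 0 4 1 3 (by decide) (by decide) (by decide) (by decide) (by decide) (by decide)
  have a3 := h 0 4 1 5 (by decide) (by decide) (by decide) (by decide) (by decide) (by decide)
  have a4 := h 0 5 1 3 (by decide) (by decide) (by decide) (by decide) (by decide) (by decide)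
  have a5 := h 0 5 1 4 (by decide) (by decide) (by decide) (by decide) (by decide) (by decide)
  have b0 := h 0 3 2 4 (by decide) (by decide) (by decide) (by decide) (by decide) (by decide)
  have b1 := h 0 3 2 5 (by decide) (by decide) (by decide) (by decide) (by decide) (by decide)
  have b2 := h 0 4 2 3 (by decide) (by decide) (by decide) (by decide) (by decide) (by decide)
  have b3 := h 0 4 2 5 (by decide) (by decide) (by decide) (by decide) (by decide) (by decide)
  have b4 := h 0 5 2 3 (by decide) (by decide) (by decide) (by decide) (by decide) (by decide)
  have b5 := h 0 5 2 4 (by decide) (by decide) (by decide) (by decide) (by decide) (by decide)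
  have c0 := h 1 3 2 4 (by decide) (by decide) (by decide) (by decide) (by decide) (by decide)
  have c1 := h 1 3 2 5 (by decide) (by decide) (by decide) (by decide) (by decide) (by decide)
  have c2 := h 1 4 2 3 (by decide) (by decide) (by decide) (by decide) (by decide) (by decide)
  have c3 := h 1 4 2 5 (by decide) (by decide) (by decide) (by decide) (by decide) (by decide)
  have c4 := h 1 5 2 3 (by decide) (by decide) (by decide) (by decide) (by decide) (by decide)
  have c5 := h 1 5 2 4 (by decide) (by decide) (by decide) (by decide) (by decide) (by decide)
  simp [ordBit] at a0 a1 a2 a3 a4 a5 b0 b1 b2 b3 b4 b5 c0 c1 c2 c3 c4 c5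
  omega

/-- Linked inside a vertex set. -/
def Lk {V : Type*} (G : SimpleGraph V) (B : Set V) : V → V → Prop :=
  Relation.ReflTransGen (fun a b => G.Adj a b ∧ a ∈ B ∧ b ∈ B)

/-- A nonempty vertex set inducing a connected subgraph. -/
def Conn {V : Type*} (G : SimpleGraph V) (B : Set V) : Prop :=
  B.Nonempty ∧ ∀ u ∈ B, ∀ v ∈ B, Lk G B u v

theorem planar_draw {V : Type*} (G : SimpleGraph V) (hG : IsPlanar G) :
    ∃ (p : V → ℂ) (F : Set V → Set ℂ), Function.Injective p ∧ (∀ X, ∀ v ∈ X, p v ∈ F X) ∧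
      (∀ X u v, u ∈ X → v ∈ X → G.Adj u v → JoinedIn (F X) (p u) (p v)) ∧
      ∀ X Y, Disjoint X Y → Disjoint (F X) (F Y) := by
  obtain ⟨pos, arc, hpos, hcont, hinj, hends, hvert, hdis⟩ := hG
  let q : ℝ × ℝ → ℂ := Complex.equivRealProdCLM.symm
  have hqc : Continuous q := Complex.equivRealProdCLM.symm.continuous
  have hqi : Function.Injective q := Complex.equivRealProdCLM.symm.injective
  have hend : ∀ e t w, arc e t = pos w → w ∈ (e : Sym2 V) := by
    intro e t w h
    obtain ⟨u, v, he, h0, h1⟩ := hends e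
    rcases hvert e t ⟨w, h.symm⟩ with rfl | rfl
    · rw [h0] at h; rw [he, ← hpos h]; simp
    · rw [h1] at h; rw [he, ← hpos h]; simp
  refine ⟨fun v => q (pos v), fun X => {z | (∃ v ∈ X, z = q (pos v)) ∨
    ∃ (e : G.edgeSet) (t : Set.Icc (0 : ℝ) 1), (∀ w ∈ (e : Sym2 V), w ∈ X) ∧ z = q (arc e t)},
    hqi.comp hpos, fun X v hv => Or.inl ⟨v, hv, rfl⟩, ?_, ?_⟩
  · intro X u v hu hv huv
    let e : G.edgeSet := ⟨s(u, v), huv⟩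
    have hX : ∀ w ∈ (e : Sym2 V), w ∈ X := by
      intro w hw
      rcases Sym2.mem_iff.1 hw with rfl | rfl <;> assumption
    obtain ⟨a, b, he, h0, h1⟩ := hends e
    let F : Set ℂ := {z | (∃ v ∈ X, z = q (pos v)) ∨
      ∃ (e : G.edgeSet) (t : Set.Icc (0 : ℝ) 1), (∀ w ∈ (e : Sym2 V), w ∈ X) ∧ z = q (arc e t)}
    have hj : JoinedIn F (q (pos a)) (q (pos b)) := by
      refine ⟨⟨⟨fun t => q (arc e t), hqc.comp (hcont e)⟩, ?_, ?_⟩, fun t => Or.inr ⟨e, t, hX, rfl⟩⟩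
      · exact congrArg q h0
      · exact congrArg q h1
    have he' : s(u, v) = s(a, b) := he
    rcases Sym2.eq_iff.1 he' with ⟨rfl, rfl⟩ | ⟨rfl, rfl⟩
    · exact hj
    · exact hj.symm
  · intro X Y hXY
    have hXY' : ∀ v, v ∈ X → v ∈ Y → False := fun v h1 h2 => Set.disjoint_left.1 hXY h1 h2
    rw [Set.disjoint_left]
    rintro z (⟨v, hv, rfl⟩ | ⟨e, t, he, rfl⟩) (⟨w, hw, h⟩ | ⟨f, s, hf, h⟩)
    · have := hpos (hqi h); subst this; exact hXY' _ hv hw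
    · exact hXY' v hv (hf v (hend f s v (hqi h).symm))
    · exact hXY' w (he w (hend e t w (hqi h))) hw
    · have h := hqi h
      by_cases hef : e = f
      · subst hef
        obtain ⟨a, b, hab, -, -⟩ := hends e
        have ha : a ∈ (e : Sym2 V) := by rw [hab]; simp
        exact hXY' a (he a ha) (hf a ha)
      · obtain ⟨w, hw⟩ := hdis e f hef t s h
        exact hXY' w (he w (hend e t w hw.symm)) (hf w (hend f s w (by rw [← h, hw])))

theorem joinedIn_of_lk {V : Type*} {G : SimpleGraph V} {p : V → ℂ} {F : Set V → Set ℂ}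
    (hmem : ∀ X, ∀ v ∈ X, p v ∈ F X)
    (hj : ∀ X u v, u ∈ X → v ∈ X → G.Adj u v → JoinedIn (F X) (p u) (p v))
    {B X : Set V} (hBX : B ⊆ X) {u v : V} (hu : u ∈ B) (h : Lk G B u v) :
    JoinedIn (F X) (p u) (p v) := by
  induction h with
  | refl => exact JoinedIn.refl (hmem X u (hBX hu))
  | tail _ hbc ih => exact ih.trans (hj X _ _ (hBX hbc.2.1) (hBX hbc.2.2) hbc.1)

theorem minor_cochain {V : Type*} (G : SimpleGraph V) (hG : IsPlanar G) {m : ℕ}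
    (B : Fin m → Set V) (E : Fin m → Fin m → Prop) (hB : ∀ i, Conn G (B i))
    (hd : ∀ i j, i ≠ j → Disjoint (B i) (B j))
    (hE : ∀ i j, E i j → ∃ u ∈ B i, ∃ v ∈ B j, G.Adj u v) :
    ∃ n : Fin m → Fin m → Fin m → ℤ, ∀ i j k l, E i j → E k l →
      i ≠ k → i ≠ l → j ≠ k → j ≠ l →
      2 * (n k i j + n j k l - n l i j - n i k l) =
        (ordBit l j - ordBit j l) + (ordBit j k - ordBit k j) + (ordBit k i - ordBit i k)
        + (ordBit i l - ordBit l i) := by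
  obtain ⟨p, F, hp, hmem, hj, hdF⟩ := planar_draw G hG
  choose r hr using fun i => (hB i).1
  have hri : Function.Injective r := by
    intro i j hij
    by_contra hne
    exact Set.disjoint_left.1 (hd i j hne) (hr i) (hij ▸ hr j)
  have hJ : ∀ i j, E i j → JoinedIn (F (B i ∪ B j)) (p (r i)) (p (r j)) := by
    intro i j h
    obtain ⟨u, hu, v, hv, huv⟩ := hE i j h
    have h1 := joinedIn_of_lk hmem hj (X := B i ∪ B j) Set.subset_union_left (hr i)
      ((hB i).2 _ (hr i) _ hu)
    have h2 := joinedIn_of_lk hmem hj (X := B i ∪ B j) Set.subset_union_right hv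
      ((hB j).2 _ hv _ (hr j))
    exact (h1.trans (hj _ u v (Or.inl hu) (Or.inr hv) huv)).trans h2
  refine exists_cochain (fun i => p (r i)) (hp.comp hri) E (fun i j h => (hJ i j h).somePath) ?_ ?_
  · intro i j h k hki hkj t heq
    have hD : Disjoint (B i ∪ B j) (B k) :=
      Set.disjoint_union_left.2 ⟨hd i k hki.symm, hd j k hkj.symm⟩
    exact Set.disjoint_left.1 (hdF _ _ hD) ((hJ i j h).somePath_mem t) (heq ▸ hmem _ _ (hr k))
  · intro i j h k l h' hik hil hjk hjl s t heq
    have hD : Disjoint (B i ∪ B j) (B k ∪ B l) :=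
      Set.disjoint_union_left.2 ⟨Set.disjoint_union_right.2 ⟨hd i k hik, hd i l hil⟩,
        Set.disjoint_union_right.2 ⟨hd j k hjk, hd j l hjl⟩⟩
    exact Set.disjoint_left.1 (hdF _ _ hD) ((hJ i j h).somePath_mem s)
      (heq ▸ (hJ k l h').somePath_mem t)

theorem no_K5_minor {V : Type*} (G : SimpleGraph V) (hG : IsPlanar G)
    (B : Fin 5 → Set V) (hB : ∀ i, Conn G (B i))
    (hd : ∀ i j, i < j → Disjoint (B i) (B j))
    (hE : ∀ i j, i < j → ∃ u ∈ B i, ∃ v ∈ B j, G.Adj u v) : False := by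
  obtain ⟨n, hn⟩ := minor_cochain G hG B (fun i j => i < j) hB
    (fun i j h => (lt_or_gt_of_ne h).elim (hd i j) (fun h => (hd j i h).symm)) hE
  exact no_cochain_K5 n hn

theorem no_K33_minor {V : Type*} (G : SimpleGraph V) (hG : IsPlanar G)
    (B : Fin 6 → Set V) (hB : ∀ i, Conn G (B i))
    (hd : ∀ i j, i < j → Disjoint (B i) (B j))
    (hE : ∀ i j, i < 3 ∧ 3 ≤ j → ∃ u ∈ B i, ∃ v ∈ B j, G.Adj u v) : False := by
  obtain ⟨n, hn⟩ := minor_cochain G hG B (fun i j => i < 3 ∧ 3 ≤ j) hB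
    (fun i j h => (lt_or_gt_of_ne h).elim (hd i j) (fun h => (hd j i h).symm)) hE
  exact no_cochain_K33 n hn

theorem Lk.symm {V : Type*} {G : SimpleGraph V} {B : Set V} {u v : V} (h : Lk G B u v) :
    Lk G B v u := by
  have : Std.Symm (fun a b => G.Adj a b ∧ a ∈ B ∧ b ∈ B) := ⟨fun a b h => ⟨h.1.symm, h.2.2, h.2.1⟩⟩
  exact Relation.ReflTransGen.stdSymm.symm _ _ h

theorem Lk.mono {V : Type*} {G : SimpleGraph V} {B C : Set V} (hBC : B ⊆ C) {u v : V}
    (h : Lk G B u v) : Lk G C u v :=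
  Relation.ReflTransGen.mono (fun _ _ h => ⟨h.1, hBC h.2.1, hBC h.2.2⟩) _ _ h

theorem Lk.trans {V : Type*} {G : SimpleGraph V} {B : Set V} {u v w : V} (h : Lk G B u v)
    (h' : Lk G B v w) : Lk G B u w := Relation.ReflTransGen.trans h h'

theorem Lk.mem {V : Type*} {G : SimpleGraph V} {B : Set V} {u v : V} (h : Lk G B u v)
    (hu : u ∈ B) : v ∈ B := by
  cases h with
  | refl => exact hu
  | tail _ h => exact h.2.2

theorem Lk.single {V : Type*} {G : SimpleGraph V} {B : Set V} {u v : V} (h : G.Adj u v)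
    (hu : u ∈ B) (hv : v ∈ B) : Lk G B u v := Relation.ReflTransGen.single ⟨h, hu, hv⟩

/-- Links inside `B` stay inside any subset closed under links. -/
theorem Lk.restrict {V : Type*} {G : SimpleGraph V} {B C : Set V} {u v : V} (h : Lk G B u v)
    (hC : ∀ z, Lk G B u z → z ∈ C) : Lk G C u v := by
  induction h with
  | refl => exact Relation.ReflTransGen.refl
  | tail h1 h2 ih => exact ih.trans (Lk.single h2.1 (hC _ h1) (hC _ (h1.tail h2)))

theorem conn_singleton {V : Type*} (G : SimpleGraph V) (v : V) : Conn G {v} := by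
  refine ⟨⟨v, rfl⟩, ?_⟩
  rintro u rfl w rfl
  exact Relation.ReflTransGen.refl

theorem conn_of_root {V : Type*} {G : SimpleGraph V} {B : Set V} (r : V) (hr : r ∈ B)
    (h : ∀ z ∈ B, Lk G B r z) : Conn G B :=
  ⟨⟨r, hr⟩, fun u hu v hv => (h u hu).symm.trans (h v hv)⟩

theorem conn_insert {V : Type*} {G : SimpleGraph V} {B : Set V} (hB : Conn G B) {v : V}
    (hv : ∃ b ∈ B, G.Adj b v) : Conn G (insert v B) := by
  obtain ⟨b, hb, hbv⟩ := hv
  refine conn_of_root b (Or.inr hb) ?_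
  rintro z (rfl | hz)
  · exact Lk.single hbv (Or.inr hb) (Or.inl rfl)
  · exact (hB.2 b hb z hz).mono (Set.subset_insert _ _)

/-- Vertices of `R` whose component (in `R`) is adjacent to both `a` and `b`. -/
def Bridge {V : Type*} (G : SimpleGraph V) (R : Set V) (a b : V) : Set V :=
  {z | z ∈ R ∧ (∃ r, Lk G R z r ∧ G.Adj r a) ∧ ∃ r, Lk G R z r ∧ G.Adj r b}

theorem bridge_conn {V : Type*} {G : SimpleGraph V} {R : Set V} {a b : V} :
    Conn G (insert a (Bridge G R a b)) := by
  refine conn_of_root a (Or.inl rfl) ?_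
  rintro z (rfl | hz)
  · exact Relation.ReflTransGen.refl
  · obtain ⟨hzR, ⟨r, hr, hra⟩, ⟨s, hs, hsb⟩⟩ := hz
    have hcl : ∀ y, Lk G R z y → y ∈ insert a (Bridge G R a b) := fun y hy =>
      Or.inr ⟨hy.mem hzR, ⟨r, hy.symm.trans hr, hra⟩, ⟨s, hy.symm.trans hs, hsb⟩⟩
    exact ((hr.restrict hcl).trans (Lk.single hra (hcl r hr) (Or.inl rfl))).symm

theorem bridge_adj {V : Type*} {G : SimpleGraph V} {R X : Set V} {a b : V} (hab : a ≠ b)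
    (hbR : b ∉ R) (hX : ∀ z ∈ X, z = a ∨ z = b ∨ z ∈ R) (h : Lk G X a b) :
    ∃ u ∈ insert a (Bridge G R a b), G.Adj u b := by
  have key : ∀ x, Lk G X a x → x = a ∨ (x ∈ R ∧ ∃ r, r ∈ R ∧ G.Adj r a ∧ Lk G R r x) ∨
      ∃ u ∈ insert a (Bridge G R a b), G.Adj u b := by
    intro x hx
    induction hx with
    | refl => exact Or.inl rfl
    | @tail y x _ hyx ih =>
      rcases ih with rfl | ⟨hyR, r, hr, hra, hry⟩ | h
      · rcases hX x hyx.2.2 with rfl | rfl | hxR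
        · exact Or.inl rfl
        · exact Or.inr (Or.inr ⟨_, Or.inl rfl, hyx.1⟩)
        · exact Or.inr (Or.inl ⟨hxR, x, hxR, hyx.1.symm, Relation.ReflTransGen.refl⟩)
      · rcases hX x hyx.2.2 with rfl | rfl | hxR
        · exact Or.inl rfl
        · exact Or.inr (Or.inr ⟨y, Or.inr ⟨hyR, ⟨r, hry.symm, hra⟩,
            ⟨y, Relation.ReflTransGen.refl, hyx.1⟩⟩, hyx.1⟩)
        · exact Or.inr (Or.inl ⟨hxR, r, hr, hra, hry.trans (Lk.single hyx.1 hyR hxR)⟩)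
      · exact Or.inr (Or.inr h)
  rcases key b h with h | h | h
  · exact absurd h.symm hab
  · exact absurd h.1 hbR
  · exact h

/-- `w` has a neighbour in `B`. -/
def Nb {V : Type*} (G : SimpleGraph V) (B : Set V) (w : V) : Prop := ∃ b ∈ B, G.Adj b w

theorem chord_sep {V : Type*} (G : SimpleGraph V) (hG : IsPlanar G) (W B : Set V)
    (hB : Conn G B) (hWB : ∀ w ∈ W, w ∉ B) {v a b c : V}
    (hv : v ∈ W) (ha : a ∈ W) (hb : b ∈ W) (hc : c ∈ W)
    (hab : a ≠ b) (hbc : b ≠ c) (hac : a ≠ c)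
    (nv : Nb G B v) (na : Nb G B a) (nb : Nb G B b) (nc : Nb G B c)
    (va : G.Adj v a) (vb : G.Adj v b) (vc : G.Adj v c)
    (h1 : Lk G (W \ {v, c}) a b) (h2 : Lk G (W \ {v, a}) b c) (h3 : Lk G (W \ {v, b}) c a) :
    False := by
  set R : Set V := W \ {v, a, b, c} with hR
  have hRW : ∀ z ∈ R, z ∈ W := fun z hz => hz.1
  have haR : a ∉ R := by simp [hR]
  have hbR : b ∉ R := by simp [hR]
  have hcR : c ∉ R := by simp [hR]
  have hvR : v ∉ R := by simp [hR]
  have claw : ∀ z ∈ R, (∃ r, Lk G R z r ∧ G.Adj r a) → (∃ r, Lk G R z r ∧ G.Adj r b) →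
      (∃ r, Lk G R z r ∧ G.Adj r c) → False := by
    rintro z hz ⟨ra, hra, hra'⟩ ⟨rb, hrb, hrb'⟩ ⟨rc, hrc, hrc'⟩
    let C : Set V := {y | Lk G R z y}
    have hCR : ∀ y ∈ C, y ∈ R := fun y hy => Lk.mem hy hz
    have hCc : Conn G C := conn_of_root z Relation.ReflTransGen.refl
      (fun y hy => Lk.restrict hy (fun _ h => h))
    obtain ⟨b1, hb1, hb1'⟩ := na
    obtain ⟨b2, hb2, hb2'⟩ := nb
    obtain ⟨b3, hb3, hb3'⟩ := nc
    refine no_K33_minor G hG ![B, {v}, C, {a}, {b}, {c}] ?_ ?_ ?_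
    · intro i
      fin_cases i
      · exact hB
      · exact conn_singleton G v
      · exact hCc
      · exact conn_singleton G a
      · exact conn_singleton G b
      · exact conn_singleton G c
    · have hBv := hWB v hv
      have hBa := hWB a ha
      have hBb := hWB b hb
      have hBc := hWB c hc
      have hBC : Disjoint B C := Set.disjoint_left.2 (fun y h1 h2 => hWB y (hRW y (hCR y h2)) h1)
      have hvC : v ∉ C := fun h => hvR (hCR _ h)
      have haC : a ∉ C := fun h => haR (hCR _ h)
      have hbC : b ∉ C := fun h => hbR (hCR _ h)
      have hcC : c ∉ C := fun h => hcR (hCR _ h)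
      have va' := va.ne
      have vb' := vb.ne
      have vc' := vc.ne
      intro i j hij
      fin_cases i <;> fin_cases j <;> first | (exfalso; revert hij; decide) | skip
      all_goals simp_all [Ne.symm]
    · rintro i j ⟨hi, hj⟩
      fin_cases i <;> fin_cases j <;>
        first | (exfalso; revert hi; decide) | (exfalso; revert hj; decide) | skip
      · exact ⟨b1, hb1, a, rfl, hb1'⟩
      · exact ⟨b2, hb2, b, rfl, hb2'⟩
      · exact ⟨b3, hb3, c, rfl, hb3'⟩
      · exact ⟨v, rfl, a, rfl, va⟩
      · exact ⟨v, rfl, b, rfl, vb⟩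
      · exact ⟨v, rfl, c, rfl, vc⟩
      · exact ⟨ra, hra, a, rfl, hra'⟩
      · exact ⟨rb, hrb, b, rfl, hrb'⟩
      · exact ⟨rc, hrc, c, rfl, hrc'⟩
  have hX1 : ∀ z ∈ W \ {v, c}, z = a ∨ z = b ∨ z ∈ R := by
    intro z hz; simp only [hR, Set.mem_sdiff, Set.mem_insert_iff, Set.mem_singleton_iff] at hz ⊢; tauto
  have hX2 : ∀ z ∈ W \ {v, a}, z = b ∨ z = c ∨ z ∈ R := by
    intro z hz; simp only [hR, Set.mem_sdiff, Set.mem_insert_iff, Set.mem_singleton_iff] at hz ⊢; tauto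
  have hX3 : ∀ z ∈ W \ {v, b}, z = c ∨ z = a ∨ z ∈ R := by
    intro z hz; simp only [hR, Set.mem_sdiff, Set.mem_insert_iff, Set.mem_singleton_iff] at hz ⊢; tauto
  obtain ⟨u1, hu1, hu1'⟩ := bridge_adj hab hbR hX1 h1
  obtain ⟨u2, hu2, hu2'⟩ := bridge_adj hbc hcR hX2 h2
  obtain ⟨u3, hu3, hu3'⟩ := bridge_adj hac.symm haR hX3 h3
  obtain ⟨b0, hb0, hb0'⟩ := nv
  obtain ⟨b1, hb1, hb1'⟩ := na
  obtain ⟨b2, hb2, hb2'⟩ := nb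
  obtain ⟨b3, hb3, hb3'⟩ := nc
  have hsub : ∀ x y z, z ∈ Bridge G R x y → z ∈ R := fun _ _ _ h => h.1
  have hDB : ∀ x y, x ∈ W → Disjoint B (insert x (Bridge G R x y)) := by
    intro x y hx
    rw [Set.disjoint_left]
    rintro z hz (rfl | h)
    · exact hWB _ hx hz
    · exact hWB z (hRW z h.1) hz
  have hDv : ∀ x y, v ≠ x → Disjoint {v} (insert x (Bridge G R x y)) := by
    intro x y hx
    rw [Set.disjoint_left]
    rintro z rfl (h | h)
    · exact hx h
    · exact hvR h.1
  have hDD : ∀ x y x' y', x ≠ x' → x ∉ R → x' ∉ R →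
      (∀ z, z ∈ Bridge G R x y → z ∈ Bridge G R x' y' → False) →
      Disjoint (insert x (Bridge G R x y)) (insert x' (Bridge G R x' y')) := by
    intro x y x' y' hx hxR hxR' hh
    rw [Set.disjoint_left]
    rintro z (rfl | h) (h' | h')
    · exact hx h'
    · exact hxR h'.1
    · exact hxR' (h' ▸ h.1)
    · exact hh z h h'
  refine no_K5_minor G hG ![B, {v}, insert a (Bridge G R a b), insert b (Bridge G R b c),
    insert c (Bridge G R c a)] ?_ ?_ ?_
  · intro i
    fin_cases i
    · exact hB
    · exact conn_singleton G v
    · exact bridge_conn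
    · exact bridge_conn
    · exact bridge_conn
  · intro i j hij
    fin_cases i <;> fin_cases j <;> first | (exfalso; revert hij; decide) | skip
    · exact Set.disjoint_singleton_right.2 (hWB v hv)
    · exact hDB a b ha
    · exact hDB b c hb
    · exact hDB c a hc
    · exact hDv a b va.ne
    · exact hDv b c vb.ne
    · exact hDv c a vc.ne
    · exact hDD a b b c hab haR hbR (fun z h h' => claw z h.1 h.2.1 h.2.2 h'.2.2)
    · exact hDD a b c a hac haR hcR (fun z h h' => claw z h.1 h.2.1 h.2.2 h'.2.1)
    · exact hDD b c c a hbc hbR hcR (fun z h h' => claw z h.1 h'.2.2 h.2.1 h.2.2)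
  · intro i j hij
    fin_cases i <;> fin_cases j <;> first | (exfalso; revert hij; decide) | skip
    · exact ⟨b0, hb0, v, rfl, hb0'⟩
    · exact ⟨b1, hb1, a, Or.inl rfl, hb1'⟩
    · exact ⟨b2, hb2, b, Or.inl rfl, hb2'⟩
    · exact ⟨b3, hb3, c, Or.inl rfl, hb3'⟩
    · exact ⟨v, rfl, a, Or.inl rfl, va⟩
    · exact ⟨v, rfl, b, Or.inl rfl, vb⟩
    · exact ⟨v, rfl, c, Or.inl rfl, vc⟩
    · exact ⟨u1, hu1, b, Or.inl rfl, hu1'⟩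
    · exact ⟨a, Or.inl rfl, u3, hu3, hu3'.symm⟩
    · exact ⟨u2, hu2, c, Or.inl rfl, hu2'⟩

/-- `W` has a proper colouring from the lists `L`. -/
def Col {V : Type*} (G : SimpleGraph V) (W : Finset V) (L : V → Finset ℕ) : Prop :=
  ∃ c : V → ℕ, (∀ w ∈ W, c w ∈ L w) ∧ ∀ u ∈ W, ∀ w ∈ W, G.Adj u w → c u ≠ c w

/-- List size conditions off the precoloured set `P`. -/
def OKL {V : Type*} (G : SimpleGraph V) (W : Finset V) (B : Set V) (L : V → Finset ℕ)
    (P : Set V) : Prop :=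
  ∀ w ∈ W, w ∉ P → 3 ≤ (L w).card ∧ (¬ Nb G B w → 5 ≤ (L w).card)

open Classical in
/-- Remove the colours `T` from the lists of the neighbours of `v` not attached to `B`. -/
noncomputable def cut {V : Type*} (G : SimpleGraph V) (B : Set V) (v : V) (T : Finset ℕ)
    (L : V → Finset ℕ) : V → Finset ℕ :=
  fun w => if G.Adj v w ∧ ¬ Nb G B w then L w \ T else L w

open Classical in
theorem okl_contract {V : Type*} {G : SimpleGraph V} {W : Finset V} {B B' : Set V}
    {L : V → Finset ℕ} {P : Set V} (h : OKL G W B L P) (v : V) (T : Finset ℕ) (hT : T.card ≤ 2)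
    (hB' : ∀ w ∈ W, ¬ Nb G B' w → ¬ Nb G B w ∧ ¬ G.Adj v w) :
    OKL G (W.erase v) B' (cut G B v T L) P := by
  intro w hw hwP
  have hwW := Finset.mem_of_mem_erase hw
  obtain ⟨h3, h5⟩ := h w hwW hwP
  constructor
  · unfold cut
    split_ifs with hc
    · have := Finset.le_card_sdiff T (L w)
      have := h5 hc.2
      omega
    · exact h3
  · intro hn
    obtain ⟨h1, h2⟩ := hB' w hwW hn
    unfold cut
    rw [if_neg (fun h => h2 h.1)]
    exact h5 h1

open Classical in
theorem col_extend {V : Type*} {G : SimpleGraph V} {W : Finset V} {B : Set V}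
    {L : V → Finset ℕ} (v : V) (T : Finset ℕ) (c : V → ℕ)
    (hc : ∀ w ∈ W.erase v, c w ∈ cut G B v T L w)
    (hc' : ∀ u ∈ W.erase v, ∀ w ∈ W.erase v, G.Adj u w → c u ≠ c w)
    (γ : ℕ) (hγT : γ ∈ T) (hγL : γ ∈ L v)
    (hγ : ∀ w ∈ W, G.Adj v w → Nb G B w → c w ≠ γ) : Col G W L := by
  have hv : ∀ w ∈ W, G.Adj v w → c w ≠ γ := by
    intro w hw hvw
    by_cases hn : Nb G B w
    · exact hγ w hw hvw hn
    · have := hc w (Finset.mem_erase.2 ⟨hvw.ne', hw⟩)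
      unfold cut at this
      rw [if_pos ⟨hvw, hn⟩, Finset.mem_sdiff] at this
      rintro rfl
      exact this.2 hγT
  refine ⟨Function.update c v γ, ?_, ?_⟩
  · intro w hw
    by_cases hwv : w = v
    · subst hwv; simpa using hγL
    · rw [Function.update_of_ne hwv]
      have := hc w (Finset.mem_erase.2 ⟨hwv, hw⟩)
      unfold cut at this
      split_ifs at this
      · exact (Finset.mem_sdiff.1 this).1
      · exact this
  · intro u hu w hw huw
    by_cases huv : u = v
    · subst huv
      rw [Function.update_self, Function.update_of_ne huw.ne']
      exact (hv w hw huw).symm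
    · rw [Function.update_of_ne huv]
      by_cases hwv : w = v
      · subst hwv
        rw [Function.update_self]
        exact hv u hu huw.symm
      · rw [Function.update_of_ne hwv]
        exact hc' u (Finset.mem_erase.2 ⟨huv, hu⟩) w (Finset.mem_erase.2 ⟨hwv, hw⟩) huw

/-- Thomassen's extension property with two adjacent precoloured vertices. -/
def PairP {V : Type*} (G : SimpleGraph V) (W : Finset V) (B : Set V) : Prop :=
  ∀ L : V → Finset ℕ, ∀ x ∈ W, ∀ y ∈ W, Nb G B x → Nb G B y → G.Adj x y → ∀ α β, α ≠ β →
    L x = {α} → L y = {β} → OKL G W B L {x, y} → Col G W L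

/-- One precoloured vertex. -/
def SingleP {V : Type*} (G : SimpleGraph V) (W : Finset V) (B : Set V) : Prop :=
  ∀ L : V → Finset ℕ, ∀ x ∈ W, Nb G B x → ∀ α, L x = {α} → OKL G W B L {x} → Col G W L

/-- No precoloured vertex. -/
def EmptyP {V : Type*} (G : SimpleGraph V) (W : Finset V) (B : Set V) : Prop :=
  ∀ L : V → Finset ℕ, OKL G W B L ∅ → Col G W L

open Classical in
/-- Splitting along a chord `v a`. -/
theorem chord_split {V : Type*} {G : SimpleGraph V} {W : Finset V} {B : Set V}
    (ih : ∀ W', W' ⊂ W → PairP G W' B) {v a b c : V} (hv : v ∈ W) (ha : a ∈ W)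
    (hb : b ∈ W) (hc : c ∈ W) (hbv : b ≠ v) (hba : b ≠ a) (hcv : c ≠ v) (hca : c ≠ a)
    (nv : Nb G B v) (na : Nb G B a) (va : G.Adj v a)
    (hsep : ¬ Lk G ((W : Set V) \ {v, a}) b c)
    (L : V → Finset ℕ) {x y : V} (hx : x ∈ W) (hy : y ∈ W) (nx : Nb G B x) (ny : Nb G B y)
    (hxy : G.Adj x y) {α β : ℕ} (hαβ : α ≠ β) (hLx : L x = {α}) (hLy : L y = {β})
    (hOK : OKL G W B L {x, y}) : Col G W L := by
  have main : ∀ A C : Finset V, A ⊂ W → C ⊂ W → (∀ w ∈ W, w ∈ A ∨ w ∈ C) →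
      v ∈ A → v ∈ C → a ∈ A → a ∈ C → (∀ u ∈ A, u ∈ C → u = v ∨ u = a) →
      (∀ u ∈ A, ∀ w ∈ C, G.Adj u w → u ∈ C ∨ w ∈ A) → x ∈ A → y ∈ A → Col G W L := by
    intro A C hA hC hcov hvA hvC haA haC hAC hadj hxA hyA
    obtain ⟨c1, hc1, hc1'⟩ := ih A hA L x hxA y hyA nx ny hxy α β hαβ hLx hLy
      (fun w hw => hOK w (hA.1 hw))
    let L2 : V → Finset ℕ := fun w => if w = v ∨ w = a then {c1 w} else L w
    obtain ⟨c2, hc2, hc2'⟩ := ih C hC L2 v hvC a haC nv na va (c1 v) (c1 a)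
      (hc1' v hvA a haA va) (by simp [L2]) (by simp [L2]) (by
        intro w hw hwP
        simp only [Set.mem_insert_iff, Set.mem_singleton_iff] at hwP
        simp only [L2, if_neg hwP]
        apply hOK w (hC.1 hw)
        rintro (rfl | rfl)
        · exact hwP (hAC _ hxA hw)
        · exact hwP (hAC _ hyA hw))
    have hagree : ∀ u ∈ A, u ∈ C → c2 u = c1 u := by
      intro u huA huC
      have := hc2 u huC
      simp only [L2, if_pos (hAC u huA huC), Finset.mem_singleton] at this
      exact this
    refine ⟨fun w => if w ∈ A then c1 w else c2 w, ?_, ?_⟩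
    · intro w hw
      by_cases hwA : w ∈ A
      · simp only [if_pos hwA]; exact hc1 w hwA
      · simp only [if_neg hwA]
        have hwC := (hcov w hw).resolve_left hwA
        have := hc2 w hwC
        have hne : ¬ (w = v ∨ w = a) := by
          rintro (rfl | rfl) <;> exact hwA (by assumption)
        simpa only [L2, if_neg hne] using this
    · have hside : ∀ u ∈ A, ∀ w ∈ C, w ∉ A → G.Adj u w → c1 u ≠ c2 w := by
        intro u hu w hw hwA huw
        have huC := (hadj u hu w hw huw).resolve_right hwA
        rw [← hagree u hu huC]
        exact hc2' u huC w hw huw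
      intro u hu w hw huw
      by_cases huA : u ∈ A <;> by_cases hwA : w ∈ A <;> simp only [huA, hwA, if_true, if_false]
      · exact hc1' u huA w hwA huw
      · exact hside u huA w ((hcov w hw).resolve_left hwA) hwA huw
      · exact (hside w hwA u ((hcov u hu).resolve_left huA) huA huw.symm).symm
      · exact hc2' u ((hcov u hu).resolve_left huA) w ((hcov w hw).resolve_left hwA) huw
  set X : Set V := (W : Set V) \ {v, a} with hX
  have hbX : b ∈ X := ⟨hb, by simp [hbv, hba]⟩
  have hcX : c ∈ X := ⟨hc, by simp [hcv, hca]⟩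
  let A : Finset V := W.filter (fun w => w = v ∨ w = a ∨ Lk G X b w)
  let C : Finset V := W.filter (fun w => w = v ∨ w = a ∨ ¬ Lk G X b w)
  have hAW : A ⊂ W := by
    refine (Finset.filter_ssubset).2 ⟨c, hc, ?_⟩
    simp [hcv, hca, hsep]
  have hCW : C ⊂ W := by
    refine (Finset.filter_ssubset).2 ⟨b, hb, ?_⟩
    have : Lk G X b b := Relation.ReflTransGen.refl
    simp [hbv, hba, this]
  have hmA : ∀ w, w ∈ A ↔ w ∈ W ∧ (w = v ∨ w = a ∨ Lk G X b w) := fun w => Finset.mem_filter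
  have hmC : ∀ w, w ∈ C ↔ w ∈ W ∧ (w = v ∨ w = a ∨ ¬ Lk G X b w) := fun w => Finset.mem_filter
  have hvA : v ∈ A := (hmA v).2 ⟨hv, Or.inl rfl⟩
  have hvC : v ∈ C := (hmC v).2 ⟨hv, Or.inl rfl⟩
  have haA : a ∈ A := (hmA a).2 ⟨ha, Or.inr (Or.inl rfl)⟩
  have haC : a ∈ C := (hmC a).2 ⟨ha, Or.inr (Or.inl rfl)⟩
  have hcov : ∀ w ∈ W, w ∈ A ∨ w ∈ C := by
    intro w hw; rw [hmA, hmC]; tauto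
  have hAC : ∀ u ∈ A, u ∈ C → u = v ∨ u = a := by
    intro u h1 h2; rw [hmA] at h1; rw [hmC] at h2; tauto
  have hadj : ∀ u ∈ A, ∀ w ∈ C, G.Adj u w → u ∈ C ∨ w ∈ A := by
    intro u hu w hw huw
    rw [hmA] at hu ⊢; rw [hmC] at hw ⊢
    by_cases h1 : u = v
    · tauto
    by_cases h2 : u = a
    · tauto
    by_cases h3 : w = v
    · tauto
    by_cases h4 : w = a
    · tauto
    have hu' : Lk G X b u := by tauto
    right
    exact ⟨hw.1, Or.inr (Or.inr (hu'.trans (Lk.single huw ⟨hu.1, by simp [h1, h2]⟩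
      ⟨hw.1, by simp [h3, h4]⟩)))⟩
  have hcase : (x ∈ A ∧ y ∈ A) ∨ (x ∈ C ∧ y ∈ C) := by
    rcases hcov x hx with h | h <;> rcases hcov y hy with h' | h'
    · exact Or.inl ⟨h, h'⟩
    · rcases hadj x h y h' hxy with k | k
      · exact Or.inr ⟨k, h'⟩
      · exact Or.inl ⟨h, k⟩
    · rcases hadj y h' x h hxy.symm with k | k
      · exact Or.inr ⟨h, k⟩
      · exact Or.inl ⟨k, h'⟩
    · exact Or.inr ⟨h, h'⟩
  rcases hcase with ⟨h, h'⟩ | ⟨h, h'⟩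
  · exact main A C hAW hCW hcov hvA hvC haA haC hAC hadj h h'
  · exact main C A hCW hAW (fun w hw => (hcov w hw).symm) hvC hvA haC haA
      (fun u h1 h2 => hAC u h2 h1) (fun u hu w hw huw => (hadj w hw u hu huw.symm).symm) h h'

open Classical in
theorem col_mono {V : Type*} {G : SimpleGraph V} {W : Finset V} {L L' : V → Finset ℕ}
    (h : ∀ w ∈ W, L' w ⊆ L w) (hc : Col G W L') : Col G W L := by
  obtain ⟨c, h1, h2⟩ := hc
  exact ⟨c, fun w hw => h w hw (h1 w hw), h2⟩

open Classical in
theorem pair_step {V : Type*} (G : SimpleGraph V) (hG : IsPlanar G) (W : Finset V) (B : Set V)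
    (hB : Conn G B) (hWB : ∀ w ∈ W, w ∉ B)
    (ih : ∀ W', W' ⊂ W → ∀ B', Conn G B' → (∀ w ∈ W', w ∉ B') →
      PairP G W' B' ∧ SingleP G W' B' ∧ EmptyP G W' B') : PairP G W B := by
  intro L x hx y hy nx ny hxy α β hαβ hLx hLy hOK
  have hcon : ∀ v ∈ W, Nb G B v → Conn G (insert v B) ∧
      (∀ w ∈ W.erase v, w ∉ insert v B) ∧
      (∀ w ∈ W, ¬ Nb G (insert v B) w → ¬ Nb G B w ∧ ¬ G.Adj v w) := by
    intro v _ nv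
    refine ⟨conn_insert hB nv, ?_, ?_⟩
    · rintro w hw (rfl | h)
      · exact (Finset.notMem_erase _ _) hw
      · exact hWB w (Finset.mem_of_mem_erase hw) h
    · intro w _ hn
      exact ⟨fun ⟨b, hb, hbw⟩ => hn ⟨b, Or.inr hb, hbw⟩, fun h => hn ⟨v, Or.inl rfl, h⟩⟩
  have hNbmono : ∀ v w, Nb G B w → Nb G (insert v B) w :=
    fun v w ⟨b, hb, hbw⟩ => ⟨b, Or.inr hb, hbw⟩
  have hcut : ∀ v T w, Nb G B w → cut G B v T L w = L w := by
    intro v T w hw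
    unfold cut
    rw [if_neg (fun h => h.2 hw)]
  by_cases hcase : ∃ v ∈ W, Nb G B v ∧ G.Adj x v ∧ v ≠ y
  · obtain ⟨v, hv, nv, hxv, hvy⟩ := hcase
    by_cases h3 : ∃ b ∈ W, ∃ c ∈ W, Nb G B b ∧ Nb G B c ∧ G.Adj v b ∧ G.Adj v c ∧
        b ≠ c ∧ x ≠ b ∧ x ≠ c
    ·
      obtain ⟨b, hb, c, hc, nb, nc, vb, vc, hbc, hxb, hxc⟩ := h3
      have ih' : ∀ W', W' ⊂ W → PairP G W' B := fun W' hW' =>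
        (ih W' hW' B hB (fun w hw => hWB w (hW'.1 hw))).1
      by_cases k1 : Lk G ((W : Set V) \ {v, c}) x b
      · by_cases k2 : Lk G ((W : Set V) \ {v, x}) b c
        · by_cases k3 : Lk G ((W : Set V) \ {v, b}) c x
          · exact (chord_sep G hG (W : Set V) B hB hWB hv hx hb hc hxb hbc hxc nv nx nb nc
              hxv.symm vb vc k1 k2 k3).elim
          · exact chord_split ih' hv hb hc hx vc.ne' hbc.symm hxv.ne hxb nv nb vb k3 L
              hx hy nx ny hxy hαβ hLx hLy hOK
        · exact chord_split ih' hv hx hb hc vb.ne' hxb.symm vc.ne' hxc.symm nv nx hxv.symm k2 L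
              hx hy nx ny hxy hαβ hLx hLy hOK
      · exact chord_split ih' hv hc hx hb hxv.ne hxc vb.ne' hbc nv nc vc k1 L
              hx hy nx ny hxy hαβ hLx hLy hOK
    ·
      push Not at h3
      have huniq : ∀ b ∈ W, ∀ c ∈ W, Nb G B b → Nb G B c → G.Adj v b → G.Adj v c →
          x ≠ b → x ≠ c → b = c := by
        intro b hb c hc nb nc vb vc h1 h2
        by_contra hne
        exact h2 (h3 b hb c hc nb nc vb vc hne h1)
      obtain ⟨hc1, hc2, hc3⟩ := hcon v hv nv
      have hsub : W.erase v ⊂ W := Finset.erase_ssubset hv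
      have hvP : v ∉ ({x, y} : Set V) := by simp [hxv.ne', hvy]
      have hLv := (hOK v hv hvP).1
      have hxE : x ∈ W.erase v := Finset.mem_erase.2 ⟨hxv.ne, hx⟩
      have hyE : y ∈ W.erase v := Finset.mem_erase.2 ⟨hvy.symm, hy⟩
      have hcol : ∀ T : Finset ℕ, T.card ≤ 2 → Col G (W.erase v) (cut G B v T L) := by
        intro T hT
        exact (ih _ hsub _ hc1 hc2).1 _ x hxE y hyE (hNbmono v x nx) (hNbmono v y ny) hxy α β hαβ
          (by rw [hcut _ _ _ nx, hLx]) (by rw [hcut _ _ _ ny, hLy])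
          (okl_contract hOK v T hT hc3)
      have hcx : ∀ (T : Finset ℕ) (c : V → ℕ),
          (∀ w ∈ W.erase v, c w ∈ cut G B v T L w) → c x = α ∧ c y = β := by
        intro T c hc
        have h1 := hc x hxE
        have h2 := hc y hyE
        rw [hcut _ _ _ nx, hLx] at h1
        rw [hcut _ _ _ ny, hLy] at h2
        exact ⟨Finset.mem_singleton.1 h1, Finset.mem_singleton.1 h2⟩
      by_cases hvy' : G.Adj v y
      · obtain ⟨γ, hγ⟩ : (L v \ {α, β}).Nonempty := by
          rw [← Finset.card_pos]
          have := Finset.le_card_sdiff ({α, β} : Finset ℕ) (L v)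
          have := Finset.card_le_two (a := α) (b := β)
          omega
        simp only [Finset.mem_sdiff, Finset.mem_insert, Finset.mem_singleton, not_or] at hγ
        obtain ⟨c, hc, hc'⟩ := hcol {γ} (by simp)
        obtain ⟨hcx', hcy'⟩ := hcx _ c hc
        refine col_extend v {γ} c hc hc' γ (by simp) hγ.1 ?_
        intro w hw hvw nw
        by_cases hwx : x = w
        · subst hwx; rw [hcx']; exact Ne.symm hγ.2.1
        · have := huniq w hw y hy nw ny hvw hvy' hwx hxy.ne
          subst this; rw [hcy']; exact Ne.symm hγ.2.2
      · obtain ⟨T, hTsub, hTcard⟩ : ∃ T ⊆ L v \ {α}, T.card = 2 := by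
          apply Finset.exists_subset_card_eq
          have := Finset.le_card_sdiff ({α} : Finset ℕ) (L v)
          simp only [Finset.card_singleton] at this
          omega
        obtain ⟨c, hc, hc'⟩ := hcol T hTcard.le
        obtain ⟨hcx', -⟩ := hcx _ c hc
        obtain ⟨γ, hγT, hγ⟩ : ∃ γ ∈ T, ∀ w ∈ W, G.Adj v w → Nb G B w → x ≠ w → c w ≠ γ := by
          by_cases hw : ∃ w ∈ W, G.Adj v w ∧ Nb G B w ∧ x ≠ w
          · obtain ⟨w, hw, hvw, nw, hxw⟩ := hw
            obtain ⟨γ, hγ, hne⟩ := Finset.exists_mem_ne (by omega : 1 < T.card) (c w)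
            refine ⟨γ, hγ, fun w' hw' hvw' nw' hxw' => ?_⟩
            rw [huniq w' hw' w hw nw' nw hvw' hvw hxw' hxw]
            exact hne.symm
          · push Not at hw
            obtain ⟨γ, hγ⟩ : T.Nonempty := by rw [← Finset.card_pos]; omega
            exact ⟨γ, hγ, fun w h1 h2 h3 h4 => absurd (hw w h1 h2 h3) h4⟩
        have hγ' := Finset.mem_sdiff.1 (hTsub hγT)
        refine col_extend v T c hc hc' γ hγT hγ'.1 ?_
        intro w hw hvw nw
        by_cases hwx : x = w
        · subst hwx; rw [hcx']
          intro h; exact hγ'.2 (by simp [h])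
        · exact hγ w hw hvw nw hwx
  ·
    push Not at hcase
    obtain ⟨hc1, hc2, hc3⟩ := hcon x hx nx
    have hyE : y ∈ W.erase x := Finset.mem_erase.2 ⟨hxy.ne', hy⟩
    obtain ⟨c, hc, hc'⟩ := (ih _ (Finset.erase_ssubset hx) _ hc1 hc2).2.1 (cut G B x {α} L) y hyE
      (hNbmono x y ny) β (by rw [hcut _ _ _ ny, hLy]) (by
        intro w hw hwy
        have := okl_contract hOK x {α} (by simp) hc3 w hw
        apply this
        rintro (rfl | h)
        · exact (Finset.notMem_erase _ _) hw
        · exact hwy h)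
    refine col_extend x {α} c hc hc' α (by simp) (by simp [hLx]) ?_
    intro w hw hxw nw
    have := hcase w hw nw hxw
    subst this
    have h2 := hc w hyE
    rw [hcut _ _ _ ny, hLy, Finset.mem_singleton] at h2
    rw [h2]; exact hαβ.symm

open Classical in
theorem all_steps {V : Type*} (G : SimpleGraph V) (hG : IsPlanar G) (W : Finset V) :
    ∀ B, Conn G B → (∀ w ∈ W, w ∉ B) → PairP G W B ∧ SingleP G W B ∧ EmptyP G W B := by
  induction W using Finset.strongInduction with
  | H W ih =>
  intro B hB hWB
  have hP : PairP G W B := pair_step G hG W B hB hWB ih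
  have hS : SingleP G W B := by
    intro L x hx nx α hLx hOK
    by_cases hcase : ∃ v ∈ W, Nb G B v ∧ G.Adj x v
    · obtain ⟨v, hv, nv, hxv⟩ := hcase
      have hLv := (hOK v hv (by simp [hxv.ne'])).1
      obtain ⟨β, hβ, hne⟩ := Finset.exists_mem_ne (by omega : 1 < (L v).card) α
      have : Col G W (Function.update L v {β}) := by
        refine hP _ x hx v hv nx nv hxv α β hne.symm ?_ (by simp) ?_
        · rw [Function.update_of_ne hxv.ne, hLx]
        · intro w hw hwP
          simp only [Set.mem_insert_iff, Set.mem_singleton_iff, not_or] at hwP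
          rw [Function.update_of_ne hwP.2]
          exact hOK w hw hwP.1
      refine col_mono ?_ this
      intro w _
      by_cases hwv : w = v
      · subst hwv; simpa using hβ
      · rw [Function.update_of_ne hwv]
    · push Not at hcase
      obtain ⟨c, hc, hc'⟩ := (ih _ (Finset.erase_ssubset hx) (insert x B) (conn_insert hB nx) (by
          rintro w hw (rfl | h)
          · exact (Finset.notMem_erase _ _) hw
          · exact hWB w (Finset.mem_of_mem_erase hw) h)).2.2 (cut G B x {α} L) (by
        intro w hw _
        refine okl_contract hOK x {α} (by simp) ?_ w hw ?_
        · intro w _ hn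
          exact ⟨fun ⟨b, hb, hbw⟩ => hn ⟨b, Or.inr hb, hbw⟩, fun h => hn ⟨x, Or.inl rfl, h⟩⟩
        · rintro rfl
          exact (Finset.notMem_erase _ _) hw)
      refine col_extend x {α} c hc hc' α (by simp) (by simp [hLx]) ?_
      intro w hw hxw nw
      exact absurd hxw (hcase w hw nw)
  refine ⟨hP, hS, ?_⟩
  intro L hOK
  by_cases hcase : ∃ v ∈ W, Nb G B v
  · obtain ⟨v, hv, nv⟩ := hcase
    have hLv := (hOK v hv (by simp)).1
    obtain ⟨β, hβ⟩ : (L v).Nonempty := by rw [← Finset.card_pos]; omega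
    have : Col G W (Function.update L v {β}) := by
      refine hS _ v hv nv β (by simp) ?_
      intro w hw hwP
      simp only [Set.mem_singleton_iff] at hwP
      rw [Function.update_of_ne hwP]
      exact hOK w hw (by simp)
    refine col_mono ?_ this
    intro w _
    by_cases hwv : w = v
    · subst hwv; simpa using hβ
    · rw [Function.update_of_ne hwv]
  · push Not at hcase
    rcases W.eq_empty_or_nonempty with rfl | ⟨v, hv⟩
    · exact ⟨fun _ => 0, by simp, by simp⟩
    have hLv := (hOK v hv (by simp)).1
    obtain ⟨β, hβ⟩ : (L v).Nonempty := by rw [← Finset.card_pos]; omega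
    obtain ⟨c, hc, hc'⟩ := (ih _ (Finset.erase_ssubset hv) {v} (conn_singleton G v) (by
        rintro w hw rfl
        exact (Finset.notMem_erase _ _) hw)).2.2 (cut G B v {β} L)
      (okl_contract hOK v {β} (by simp) (fun w hw hn =>
        ⟨hcase w hw, fun h => hn ⟨v, rfl, h⟩⟩))
    refine col_extend v {β} c hc hc' β (by simp) hβ ?_
    intro w hw _ nw
    exact absurd nw (hcase w hw)

/-- Thomassen's theorem: every planar graph is 5-choosable. -/
theorem planar_five_choosable {V : Type*} [Fintype V] (G : SimpleGraph V)
    (hG : IsPlanar G) (L : V → Finset ℕ) (hL : ∀ v, 5 ≤ (L v).card) :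
    ∃ c : V → ℕ, (∀ v, c v ∈ L v) ∧ ∀ u v, G.Adj u v → c u ≠ c v := by
  classical
  rcases isEmpty_or_nonempty V with hV | ⟨⟨v⟩⟩
  · exact ⟨fun _ => 0, fun v => hV.elim v, fun v => hV.elim v⟩
  obtain ⟨β, hβ⟩ : (L v).Nonempty := by
    rw [← Finset.card_pos]
    have := hL v
    omega
  have hOK : OKL G Finset.univ ∅ L ∅ := fun w _ _ => ⟨by have := hL w; omega, fun _ => hL w⟩
  obtain ⟨c, hc, hc'⟩ := (all_steps G hG (Finset.univ.erase v) {v} (conn_singleton G v) (by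
      rintro w hw rfl
      exact (Finset.notMem_erase _ _) hw)).2.2 (cut G ∅ v {β} L)
    (okl_contract hOK v {β} (by simp) (fun w _ hn =>
      ⟨fun ⟨b, hb, _⟩ => hb, fun h => hn ⟨v, rfl, h⟩⟩))
  obtain ⟨d, hd, hd'⟩ := col_extend (B := ∅) v {β} c hc hc' β (by simp) hβ
    (fun w _ _ ⟨b, hb, _⟩ => hb.elim)
  exact ⟨d, fun w => hd w (Finset.mem_univ w),
    fun u w => hd' u (Finset.mem_univ u) w (Finset.mem_univ w)⟩
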